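/- Let n ≥ 1 and let X ⊆ [0,1]^n be a nonempty closed set that coincides with the closure of its interior, where interior and closure are taken relative to the space [0,1]^n. Then McN(X) is hopfian: every surjective MV-endomorphism of McN(X) is injective. (In particular, if X is an n-dimensional manifold with boundary embedded in [0,1]^n then McN(X) is hopfian.) -/

import Mathlib

open Set BigOperators

/-- The unit cube `[0,1]^n` as a subset of `Fin n → ℝ`. -/
def cube (n : ℕ) : Set (Fin n → ℝ) := Set.Icc 0 1

/-- An (affine) linear polynomial with integer coefficients. -/
def IsAffineZ {n : ℕ} (p : (Fin n → ℝ) → ℝ) : Prop :=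
  ∃ (m : ℤ) (c : Fin n → ℤ), ∀ x, p x = (m : ℝ) + ∑ i, (c i : ℝ) * x i

/-- A McNaughton function on `[0,1]^n`: continuous, `[0,1]`-valued, and agreeing at each
point of the cube with one of finitely many affine polynomials with integer coefficients. -/
def IsMcNaughton {n : ℕ} (f : (Fin n → ℝ) → ℝ) : Prop :=
  ContinuousOn f (cube n) ∧ (∀ x ∈ cube n, f x ∈ Set.Icc (0:ℝ) 1) ∧
  ∃ (u : ℕ) (p : Fin u → (Fin n → ℝ) → ℝ),
    (∀ j, IsAffineZ (p j)) ∧ ∀ x ∈ cube n, ∃ j, f x = p j x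

/-- `McN X`: restrictions to `X` of McNaughton functions on `[0,1]^n`. -/
def McN {n : ℕ} (X : Set (Fin n → ℝ)) : Set (↥X → ℝ) :=
  {g : ↥X → ℝ | ∃ f, IsMcNaughton (n := n) f ∧ ∀ x : X, g x = f x.1}

/-- Pointwise MV-negation `¬f = 1 - f`. -/
def mvNeg {α : Type*} (f : α → ℝ) : α → ℝ := fun x => 1 - f x

/-- Pointwise MV-sum `f ⊕ g = min(1, f + g)`. -/
def mvOplus {α : Type*} (f g : α → ℝ) : α → ℝ := fun x => min 1 (f x + g x)

/-- A point all of whose coordinates are rational. -/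
def IsRationalPoint {n : ℕ} (x : Fin n → ℝ) : Prop := ∀ i, ∃ q : ℚ, x i = (q : ℝ)

/-- An MV-endomorphism of `McN X`. -/
def IsMVEndo {n : ℕ} (X : Set (Fin n → ℝ)) (σ : (↥X → ℝ) → (↥X → ℝ)) : Prop :=
  Set.MapsTo σ (McN X) (McN X) ∧
  σ (fun _ => 0) = (fun _ => 0) ∧
  (∀ f ∈ McN X, σ (mvNeg f) = mvNeg (σ f)) ∧
  (∀ f ∈ McN X, ∀ g ∈ McN X, σ (mvOplus f g) = mvOplus (σ f) (σ g))

open MeasureTheory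

section EvaluationHom

/-- Truncation of a real number to the unit interval. -/
def unitClamp (t : ℝ) : ℝ := max 0 (min 1 t)

lemma unitClamp_of_nonpos {t : ℝ} (h : t ≤ 0) : unitClamp t = 0 := by
  unfold unitClamp
  rw [min_eq_right (by linarith), max_eq_left h]

lemma unitClamp_of_one_le {t : ℝ} (h : 1 ≤ t) : unitClamp t = 1 := by
  unfold unitClamp
  rw [min_eq_left h, max_eq_right zero_le_one]

lemma nonpos_of_unitClamp_eq_zero {t : ℝ} (h : unitClamp t = 0) : t ≤ 0 := by
  unfold unitClamp at h
  by_contra! ht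
  have : 0 < min 1 t := lt_min one_pos ht
  linarith [le_max_right 0 (min 1 t)]

/-- Truncation of a sum, written with the Łukasiewicz operations. -/
lemma unitClamp_add {t g : ℝ} (h0 : 0 ≤ g) (h1 : g ≤ 1) :
    unitClamp (t + g) =
      1 - min 1 ((1 - min 1 (unitClamp t + g)) + (1 - unitClamp (t + 1))) := by
  unfold unitClamp
  grind

variable {α : Type*}

/-- A real-valued MV-homomorphism commutes with `g ↦ unitClamp (m * g - k)`. -/
lemma unitClamp_mem_and_map {M : Set (α → ℝ)} (hrange : ∀ f ∈ M, ∀ x, f x ∈ Icc (0 : ℝ) 1)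
    (hzero : (fun _ => 0) ∈ M) (hneg : ∀ f ∈ M, mvNeg f ∈ M)
    (hoplus : ∀ f ∈ M, ∀ g ∈ M, mvOplus f g ∈ M) {φ : (α → ℝ) → ℝ}
    (φrange : ∀ f ∈ M, φ f ∈ Icc (0 : ℝ) 1) (φzero : φ (fun _ => 0) = 0)
    (φneg : ∀ f ∈ M, φ (mvNeg f) = 1 - φ f)
    (φoplus : ∀ f ∈ M, ∀ g ∈ M, φ (mvOplus f g) = min 1 (φ f + φ g))
    {g : α → ℝ} (hg : g ∈ M) (m : ℕ) (k : ℤ) :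
    (fun x => unitClamp (m * g x - k)) ∈ M ∧
      φ (fun x => unitClamp (m * g x - k)) = unitClamp (m * φ g - k) := by
  induction m generalizing k with
  | zero =>
    rcases le_or_gt 0 k with hk | hk
    · have hk' : -(k : ℝ) ≤ 0 := by simpa using hk
      simp [unitClamp_of_nonpos hk', hzero, φzero]
    · have hk' : 1 ≤ -(k : ℝ) := by
        have : k ≤ -1 := by omega
        have : (k : ℝ) ≤ -1 := by exact_mod_cast this
        linarith
      have hone : mvNeg (fun _ : α => (0 : ℝ)) = fun _ => 1 := by funext; simp [mvNeg]
      have h1 := hneg _ hzero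
      have h2 := φneg _ hzero
      rw [hone] at h1 h2
      simp [unitClamp_of_one_le hk', h1, h2, φzero]
  | succ m ih =>
    obtain ⟨ha, ha'⟩ := ih k
    obtain ⟨hb, hb'⟩ := ih (k - 1)
    have key (t : ℝ) (h : t ∈ Icc (0 : ℝ) 1) :
        unitClamp ((m + 1 : ℕ) * t - k) = 1 - min 1 ((1 - min 1 (unitClamp (m * t - k) + t)) +
          (1 - unitClamp (m * t - (k - 1 : ℤ)))) := by
      have := unitClamp_add (t := m * t - k) h.1 h.2
      convert this using 3
      · push_cast; ring
      · push_cast; ring_nf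
    have heq : (fun x => unitClamp ((m + 1 : ℕ) * g x - k)) =
        mvNeg (mvOplus (mvNeg (mvOplus (fun x => unitClamp (m * g x - k)) g))
          (mvNeg (fun x => unitClamp (m * g x - (k - 1 : ℤ))))) := by
      funext x
      exact key _ (hrange g hg x)
    have h1 := hoplus _ ha _ hg
    have h2 := hneg _ h1
    have h3 := hneg _ hb
    have h4 := hoplus _ h2 _ h3
    rw [heq, key _ (φrange g hg)]
    refine ⟨hneg _ h4, ?_⟩
    rw [φneg _ h4, φoplus _ h2 _ h3, φneg _ h1, φneg _ hb, φoplus _ ha _ hg, ha', hb']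

lemma exists_nat_forall_one_le_mul [TopologicalSpace α] [CompactSpace α] [Nonempty α]
    {f : α → ℝ} (hf : Continuous f) (hpos : ∀ x, 0 < f x) : ∃ N : ℕ, ∀ x, 1 ≤ N * f x := by
  obtain ⟨z, -, hz⟩ := isCompact_univ.exists_isMinOn univ_nonempty hf.continuousOn
  obtain ⟨N, hN⟩ := exists_nat_ge (1 / f z)
  refine ⟨N, fun x => ?_⟩
  rw [div_le_iff₀ (hpos z)] at hN
  exact hN.trans (mul_le_mul_of_nonneg_left (hz (mem_univ x)) N.cast_nonneg)

/-- On a compact space, `[0,1]`-valued homomorphisms of an MV-algebra of continuous functions are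
evaluations at points. -/
theorem exists_forall_eq_eval [TopologicalSpace α] [CompactSpace α] [Nonempty α]
    {M : Set (α → ℝ)} (hcont : ∀ f ∈ M, Continuous f)
    (hrange : ∀ f ∈ M, ∀ x, f x ∈ Icc (0 : ℝ) 1)
    (hzero : (fun _ => 0) ∈ M) (hneg : ∀ f ∈ M, mvNeg f ∈ M)
    (hoplus : ∀ f ∈ M, ∀ g ∈ M, mvOplus f g ∈ M) {φ : (α → ℝ) → ℝ}
    (φrange : ∀ f ∈ M, φ f ∈ Icc (0 : ℝ) 1) (φzero : φ (fun _ => 0) = 0)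
    (φneg : ∀ f ∈ M, φ (mvNeg f) = 1 - φ f)
    (φoplus : ∀ f ∈ M, ∀ g ∈ M, φ (mvOplus f g) = min 1 (φ f + φ g)) :
    ∃ y, ∀ f ∈ M, φ f = f y := by
  have clamp {g} (hg : g ∈ M) (m : ℕ) (k : ℤ) :=
    unitClamp_mem_and_map hrange hzero hneg hoplus φrange φzero φneg φoplus hg m k
  let K := {f : α → ℝ // f ∈ M ∧ φ f = 0}
  have : Nonempty K := ⟨⟨_, hzero, φzero⟩⟩
  obtain ⟨y, hy⟩ : (⋂ f : K, {x | f.1 x = 0}).Nonempty := by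
    have hclosed (f : K) : IsClosed {x | f.1 x = 0} :=
      isClosed_eq (hcont _ f.2.1) continuous_const
    refine IsCompact.nonempty_iInter_of_directed_nonempty_isCompact_isClosed _ ?_ ?_
      (fun f => (hclosed f).isCompact) hclosed
    · rintro ⟨f, hf, hf0⟩ ⟨g, hg, hg0⟩
      refine ⟨⟨mvOplus f g, hoplus f hf g hg, by rw [φoplus f hf g hg, hf0, hg0]; simp⟩,
        fun x hx => ?_, fun x hx => ?_⟩ <;>
      · have h1 := (hrange f hf x).1
        have h2 := (hrange g hg x).1
        simp only [mvOplus, mem_ofPred_eq] at hx ⊢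
        grind
    · rintro ⟨f, hf, hf0⟩
      by_contra hempty
      have hpos (x : α) : 0 < f x := by
        refine lt_of_le_of_ne (hrange f hf x).1 fun h => hempty ⟨x, h.symm⟩
      obtain ⟨N, hN⟩ := exists_nat_forall_one_le_mul (hcont f hf) hpos
      have h1 := (clamp hf N 0).2
      have h2 := φneg _ hzero
      have h3 : (fun x => unitClamp (N * f x - (0 : ℤ))) = mvNeg (fun _ => 0) := by
        funext x
        rw [unitClamp_of_one_le (by simpa using hN x)]
        simp [mvNeg]
      rw [h3, h2, φzero, hf0, unitClamp_of_nonpos (by simp)] at h1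
      norm_num at h1
  rw [mem_iInter] at hy
  have hle (g : α → ℝ) (hg : g ∈ M) : g y ≤ φ g := by
    by_contra! hlt
    obtain ⟨m, hm⟩ := exists_nat_gt (1 / (g y - φ g))
    rw [div_lt_iff₀ (by linarith)] at hm
    obtain ⟨hmem, hval⟩ := clamp hg m ⌈m * φ g⌉
    rw [unitClamp_of_nonpos (by linarith [Int.le_ceil (m * φ g)])] at hval
    have := nonpos_of_unitClamp_eq_zero (hy ⟨_, hmem, hval⟩)
    linarith [Int.ceil_lt_add_one (m * φ g)]
  refine ⟨y, fun f hf => le_antisymm ?_ (hle f hf)⟩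
  have := hle _ (hneg f hf)
  rw [φneg f hf] at this
  simp only [mvNeg] at this
  linarith

end EvaluationHom

section McNaughton

variable {n : ℕ}

lemma IsMcNaughton.of_finite {f : (Fin n → ℝ) → ℝ} {ι : Type*} [Finite ι]
    (hc : ContinuousOn f (cube n)) (hr : ∀ x ∈ cube n, f x ∈ Icc (0 : ℝ) 1)
    (p : ι → (Fin n → ℝ) → ℝ) (hp : ∀ j, IsAffineZ (p j))
    (h : ∀ x ∈ cube n, ∃ j, f x = p j x) : IsMcNaughton f := by
  obtain ⟨u, ⟨e⟩⟩ := Finite.exists_equiv_fin ι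
  refine ⟨hc, hr, u, fun j => p (e.symm j), fun j => hp _, fun x hx => ?_⟩
  obtain ⟨j, hj⟩ := h x hx
  exact ⟨e j, by simpa using hj⟩

lemma isAffineZ_const (m : ℤ) : IsAffineZ (n := n) (fun _ => (m : ℝ)) := ⟨m, 0, by simp⟩

lemma isAffineZ_apply (i : Fin n) : IsAffineZ (fun x : Fin n → ℝ => x i) :=
  ⟨0, Pi.single i 1, fun x => by simp [Pi.single_apply]⟩

lemma IsAffineZ.add {p q : (Fin n → ℝ) → ℝ} (hp : IsAffineZ p) (hq : IsAffineZ q) :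
    IsAffineZ (fun x => p x + q x) := by
  obtain ⟨m, c, h⟩ := hp
  obtain ⟨m', c', h'⟩ := hq
  refine ⟨m + m', c + c', fun x => ?_⟩
  simp [h, h', add_mul, Finset.sum_add_distrib]
  ring

lemma IsAffineZ.one_sub {p : (Fin n → ℝ) → ℝ} (hp : IsAffineZ p) :
    IsAffineZ (fun x => 1 - p x) := by
  obtain ⟨m, c, h⟩ := hp
  refine ⟨1 - m, -c, fun x => ?_⟩
  simp [h]
  ring

lemma isMcNaughton_zero : IsMcNaughton (n := n) (fun _ => 0) :=
  .of_finite (ι := Unit) continuousOn_const (by simp) (fun _ _ => 0)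
    (fun _ => by simpa using isAffineZ_const 0) (by simp)

lemma isMcNaughton_apply (i : Fin n) : IsMcNaughton (fun x : Fin n → ℝ => x i) :=
  .of_finite (ι := Unit) (by fun_prop) (fun x hx => ⟨hx.1 i, hx.2 i⟩) (fun _ x => x i)
    (fun _ => isAffineZ_apply i) (by simp)

lemma IsMcNaughton.mvNeg {f : (Fin n → ℝ) → ℝ} (hf : IsMcNaughton f) :
    IsMcNaughton (mvNeg f) := by
  obtain ⟨hc, hr, u, p, hp, h⟩ := hf
  refine .of_finite (continuousOn_const.sub hc) (fun x hx => ?_) (fun j x => 1 - p j x)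
    (fun j => (hp j).one_sub) (fun x hx => ?_)
  · have := hr x hx
    simp only [_root_.mvNeg, mem_Icc] at this ⊢
    constructor <;> linarith
  · obtain ⟨j, hj⟩ := h x hx
    exact ⟨j, by simp [_root_.mvNeg, hj]⟩

lemma IsMcNaughton.mvOplus {f g : (Fin n → ℝ) → ℝ} (hf : IsMcNaughton f) (hg : IsMcNaughton g) :
    IsMcNaughton (mvOplus f g) := by
  obtain ⟨hc, hr, u, p, hp, h⟩ := hf
  obtain ⟨hc', hr', u', p', hp', h'⟩ := hg
  refine .of_finite (ι := Option (Fin u × Fin u')) (continuousOn_const.inf (hc.add hc'))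
    (fun x hx => ⟨le_min zero_le_one (add_nonneg (hr x hx).1 (hr' x hx).1), min_le_left _ _⟩)
    (fun j x => j.elim 1 fun j => p j.1 x + p' j.2 x) ?_ (fun x hx => ?_)
  · rintro (_ | j)
    · simpa using isAffineZ_const 1
    · exact (hp j.1).add (hp' j.2)
  · obtain ⟨j, hj⟩ := h x hx
    obtain ⟨j', hj'⟩ := h' x hx
    rcases min_choice 1 (f x + g x) with h | h
    · exact ⟨none, h⟩
    · exact ⟨some (j, j'), h.trans (by rw [hj, hj']; rfl)⟩

variable {X : Set (Fin n → ℝ)}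

lemma zero_mem_McN : (fun _ => 0) ∈ McN X := ⟨_, isMcNaughton_zero, fun _ => rfl⟩

lemma apply_mem_McN (i : Fin n) : (fun x : X => x.1 i) ∈ McN X :=
  ⟨_, isMcNaughton_apply i, fun _ => rfl⟩

lemma mvNeg_mem_McN {f : X → ℝ} (hf : f ∈ McN X) : mvNeg f ∈ McN X := by
  obtain ⟨F, hF, h⟩ := hf
  exact ⟨_, hF.mvNeg, fun x => by simp [mvNeg, h]⟩

lemma mvOplus_mem_McN {f g : X → ℝ} (hf : f ∈ McN X) (hg : g ∈ McN X) : mvOplus f g ∈ McN X := by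
  obtain ⟨F, hF, h⟩ := hf
  obtain ⟨G, hG, h'⟩ := hg
  exact ⟨_, hF.mvOplus hG, fun x => by simp [mvOplus, h, h']⟩

lemma continuous_of_mem_McN (hX : X ⊆ cube n) {f : X → ℝ} (hf : f ∈ McN X) : Continuous f := by
  obtain ⟨F, hF, h⟩ := hf
  rw [funext h]
  exact continuousOn_iff_continuous_domRestrict.1 (hF.1.mono hX)

lemma range_of_mem_McN (hX : X ⊆ cube n) {f : X → ℝ} (hf : f ∈ McN X) (x : X) :
    f x ∈ Icc (0 : ℝ) 1 := by
  obtain ⟨F, hF, h⟩ := hf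
  rw [h]
  exact hF.2.1 _ (hX x.2)

/-- Every MV-endomorphism of `McN X`, for `X` compact, is composition with a self-map of `X`. -/
theorem IsMVEndo.exists_comp (hX : X ⊆ cube n) (hcomp : IsCompact X) (hne : X.Nonempty)
    {σ : (X → ℝ) → (X → ℝ)} (hσ : IsMVEndo X σ) :
    ∃ η : X → X, ∀ f ∈ McN X, σ f = f ∘ η := by
  obtain ⟨hmaps, hσ0, hσneg, hσoplus⟩ := hσ
  have := isCompact_iff_compactSpace.1 hcomp
  have := hne.to_subtype
  have (x : X) : ∃ y, ∀ f ∈ McN X, σ f x = f y :=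
    exists_forall_eq_eval (φ := fun f => σ f x) (fun f => continuous_of_mem_McN hX)
      (fun f => range_of_mem_McN hX) zero_mem_McN (fun f => mvNeg_mem_McN)
      (fun f hf g => mvOplus_mem_McN hf) (fun f hf => range_of_mem_McN hX (hmaps hf) x)
      (congrFun hσ0 x) (fun f hf => congrFun (hσneg f hf) x)
      (fun f hf g hg => congrFun (hσoplus f hf g hg) x)
  choose η hη using this
  exact ⟨η, fun f hf => funext fun x => hη x f hf⟩

end McNaughton

section Volume

variable {n : ℕ}

/-- The affine self-map of `ℝⁿ` with integer matrix `C` and integer translation vector `m`. -/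
def intAffineMap (C : Matrix (Fin n) (Fin n) ℤ) (m : Fin n → ℤ) :
    (Fin n → ℝ) →ᵃ[ℝ] (Fin n → ℝ) :=
  (Matrix.toLin' (C.map (Int.cast : ℤ → ℝ))).toAffineMap +
    AffineMap.const ℝ (Fin n → ℝ) (fun i => (m i : ℝ))

lemma intAffineMap_apply (C : Matrix (Fin n) (Fin n) ℤ) (m : Fin n → ℤ) (x : Fin n → ℝ)
    (i : Fin n) : intAffineMap C m x i = m i + ∑ j, (C i j : ℝ) * x j := by
  simp [intAffineMap, Matrix.mulVec, dotProduct, add_comm]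

lemma intAffineMap_linear (C : Matrix (Fin n) (Fin n) ℤ) (m : Fin n → ℤ) :
    (intAffineMap C m).linear = Matrix.toLin' (C.map (Int.cast : ℤ → ℝ)) := by
  simp [intAffineMap]

lemma det_intAffineMap_linear (C : Matrix (Fin n) (Fin n) ℤ) (m : Fin n → ℤ) :
    LinearMap.det (intAffineMap C m).linear = (C.det : ℝ) := by
  rw [intAffineMap_linear, LinearMap.det_toLin']
  exact (Int.cast_det C).symm

lemma volume_image_affineMap (B : (Fin n → ℝ) →ᵃ[ℝ] (Fin n → ℝ)) (s : Set (Fin n → ℝ)) :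
    volume (B '' s) = ENNReal.ofReal |LinearMap.det B.linear| * volume s := by
  have : B '' s = (fun z => z + B 0) '' (B.linear '' s) := by
    rw [image_image]
    exact image_congr fun x _ => congrFun (AffineMap.decomp B) x
  rw [this, image_add_right, measure_preimage_add_right, Measure.addHaar_image_linearMap]

/-- If an integer affine map has an integer affine left inverse on `s`, then it does not increase
the volume of `s`. -/
lemma volume_image_intAffineMap_le {C D : Matrix (Fin n) (Fin n) ℤ} {m k : Fin n → ℤ}
    {s : Set (Fin n → ℝ)} (hs : ∀ y ∈ s, intAffineMap D k (intAffineMap C m y) = y) :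
    volume (intAffineMap C m '' s) ≤ volume s := by
  rw [volume_image_affineMap, det_intAffineMap_linear]
  rcases eq_or_ne (volume s) 0 with h0 | h0
  · simp [h0]
  have hid : (intAffineMap D k).comp (intAffineMap C m) = AffineMap.id ℝ _ := by
    let E : AffineSubspace ℝ (Fin n → ℝ) :=
      { carrier := {y | intAffineMap D k (intAffineMap C m y) = y}
        smul_vsub_vadd_mem' := by
          intro c p₁ p₂ p₃ h₁ h₂ h₃
          simp only [mem_ofPred_eq] at *
          rw [AffineMap.map_vadd, AffineMap.map_vadd, map_smul, map_smul,
            AffineMap.linearMap_vsub, AffineMap.linearMap_vsub, h₁, h₂, h₃] }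
    have hE : E = ⊤ := by
      by_contra hE
      exact h0 (measure_mono_null (t := (E : Set (Fin n → ℝ))) hs
        (Measure.addHaar_affineSubspace volume E hE))
    ext1 y
    have : y ∈ E := hE ▸ AffineSubspace.mem_top ℝ _ y
    exact this
  have hdet : D.det * C.det = 1 := by
    have := congrArg (fun A => LinearMap.det A.linear) hid
    simp only [AffineMap.comp_linear, LinearMap.det_comp, det_intAffineMap_linear,
      AffineMap.id_linear, LinearMap.det_id] at this
    exact_mod_cast this
  have hunit : |C.det| = 1 := Int.isUnit_iff_abs_eq.1 (IsUnit.of_mul_eq_one_right _ hdet)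
  have : |(C.det : ℝ)| = 1 := by exact_mod_cast hunit
  simp [this]

/-- A map that does not increase measure on subsets of each member of a finite measurable cover
does not increase measure. -/
lemma measure_image_le_of_cover {α β ι : Type*} [MeasurableSpace α] [MeasurableSpace β]
    {μ : Measure α} {ν : Measure β} {g : α → β} (t : Finset ι) {F : ι → Set α}
    (hF : ∀ i ∈ t, MeasurableSet (F i)) (hg : ∀ i ∈ t, ∀ s ⊆ F i, ν (g '' s) ≤ μ s) {Y : Set α}
    (hY : Y ⊆ ⋃ i ∈ t, F i) : ν (g '' Y) ≤ μ Y := by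
  classical
  induction t using Finset.induction_on generalizing Y with
  | empty => simp_all
  | insert a t _ ih =>
    calc ν (g '' Y) = ν (g '' (Y ∩ F a) ∪ g '' (Y \ F a)) := by
          rw [← image_union, inter_union_sdiff]
      _ ≤ ν (g '' (Y ∩ F a)) + ν (g '' (Y \ F a)) := measure_union_le _ _
      _ ≤ μ (Y ∩ F a) + μ (Y \ F a) := by
          gcongr
          · exact hg a (Finset.mem_insert_self a t) _ inter_subset_right
          · refine ih (fun i hi => hF i (Finset.mem_insert_of_mem hi))
              (fun i hi => hg i (Finset.mem_insert_of_mem hi)) ?_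
            rintro y ⟨hy, hya⟩
            simpa [hya] using hY hy
      _ = μ Y := measure_inter_add_sdiff _ (hF a (Finset.mem_insert_self a t))

/-- A map with McNaughton coordinates agrees pointwise with one of finitely many integer affine
maps. -/
lemma exists_finset_intAffineMap {f : Fin n → (Fin n → ℝ) → ℝ} (hf : ∀ i, IsMcNaughton (f i)) :
    ∃ t : Finset (Matrix (Fin n) (Fin n) ℤ × (Fin n → ℤ)),
      ∀ x ∈ cube n, ∃ P ∈ t, (fun i => f i x) = intAffineMap P.1 P.2 x := by
  classical
  choose hc hr u p hp h using hf
  choose m c hmc using hp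
  refine ⟨Finset.univ.image fun J : ∀ i, Fin (u i) =>
    (fun i => c i (J i), fun i => m i (J i)), fun x hx => ?_⟩
  choose J hJ using fun i => h i x hx
  refine ⟨_, Finset.mem_image_of_mem _ (Finset.mem_univ J), funext fun i => ?_⟩
  rw [hJ, hmc, intAffineMap_apply]

/-- If maps `H` and `G` have McNaughton coordinates and `G` is a left inverse of `H` on the closed
set `X`, which `H` maps into itself, then `H` does not decrease the volume of `X`. -/
theorem volume_le_volume_image {X : Set (Fin n → ℝ)} (hX : X ⊆ cube n) (hcl : IsClosed X)
    {H G : Fin n → (Fin n → ℝ) → ℝ} (hH : ∀ i, IsMcNaughton (H i)) (hG : ∀ i, IsMcNaughton (G i))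
    (hmaps : MapsTo (fun x i => H i x) X X)
    (hinv : LeftInvOn (fun x i => G i x) (fun x i => H i x) X) :
    volume X ≤ volume ((fun x i => H i x) '' X) := by
  obtain ⟨t, ht⟩ := exists_finset_intAffineMap hH
  obtain ⟨t', ht'⟩ := exists_finset_intAffineMap hG
  let F : (Matrix (Fin n) (Fin n) ℤ × (Fin n → ℤ)) × (Matrix (Fin n) (Fin n) ℤ × (Fin n → ℤ)) →
      Set (Fin n → ℝ) := fun P => {y | y ∈ X ∧ (fun i => G i y) = intAffineMap P.2.1 P.2.2 y} ∩
        {y | intAffineMap P.1.1 P.1.2 (intAffineMap P.2.1 P.2.2 y) = y}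
  have hcont (P : Matrix (Fin n) (Fin n) ℤ × (Fin n → ℤ)) : Continuous (intAffineMap P.1 P.2) :=
    AffineMap.continuous_of_finiteDimensional _
  have hGc : ContinuousOn (fun x i => G i x) X :=
    continuousOn_pi.2 fun i => (hG i).1.mono hX
  have key := measure_image_le_of_cover (μ := volume) (ν := volume) (g := fun x i => G i x)
    (t ×ˢ t') (F := F) (Y := (fun x i => H i x) '' X) ?_ ?_ ?_
  · rwa [hinv.image_image] at key
  · intro P _
    refine IsClosed.measurableSet (IsClosed.inter ?_ ?_)
    · have := (hGc.sub (hcont P.2).continuousOn).preimage_isClosed_of_isClosed hcl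
        (isClosed_singleton (x := (0 : Fin n → ℝ)))
      convert this using 1
      ext y
      simp [sub_eq_zero]
    · exact isClosed_eq ((hcont P.1).comp (hcont P.2)) continuous_id
  · intro P _ s hs
    have : (fun x i => G i x) '' s = intAffineMap P.2.1 P.2.2 '' s :=
      image_congr fun y hy => (hs hy).1.2
    rw [this]
    exact volume_image_intAffineMap_le fun y hy => (hs hy).2
  · rintro _ ⟨x, hx, rfl⟩
    obtain ⟨P, hP, hPx⟩ := ht x (hX hx)
    obtain ⟨Q, hQ, hQx⟩ := ht' _ (hX (hmaps hx))
    refine mem_biUnion (x := (P, Q)) (by simp [hP, hQ]) ⟨⟨hmaps hx, hQx⟩, ?_⟩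
    have hGx := hinv hx
    simp only [mem_ofPred_eq] at hGx hQx ⊢
    rw [← hQx, hGx, hPx]

lemma closure_interior_cube : closure (interior (cube n)) = cube n := by
  have hne : (interior (cube n)).Nonempty := by
    refine ⟨fun _ => 1 / 2, ?_⟩
    rw [cube, ← pi_univ_Icc, interior_pi_set finite_univ]
    intro i _
    norm_num [interior_Icc]
  exact ((convex_Icc (𝕜 := ℝ) 0 1).closure_interior_eq_closure_of_nonempty_interior hne).trans
    isClosed_Icc.closure_eq

/-- In a relatively regular closed subset of the cube, a closed subset of full volume is
everything. -/
lemma subset_of_volume_le {X Y : Set (Fin n → ℝ)} (hX : X ⊆ cube n)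
    (hreg : (Subtype.val ⁻¹' X : Set (cube n)) =
      closure (interior (Subtype.val ⁻¹' X : Set (cube n))))
    (hYX : Y ⊆ X) (hY : IsClosed Y) (hvol : volume X ≤ volume Y) : X ⊆ Y := by
  have hfin : volume Y ≠ ⊤ :=
    ((measure_mono (hYX.trans hX)).trans_lt (isCompact_Icc.measure_lt_top)).ne
  have hnull : volume (X \ Y) = 0 := by
    rw [measure_sdiff hYX hY.measurableSet.nullMeasurableSet hfin, tsub_eq_zero_of_le hvol]
  intro x hx
  by_contra hxY
  have hxcl : (⟨x, hX hx⟩ : cube n) ∈ closure (interior (Subtype.val ⁻¹' X : Set (cube n))) := by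
    rw [← hreg]
    exact hx
  obtain ⟨z, hzY, hz⟩ := mem_closure_iff.1 hxcl _
    (hY.isOpen_compl.preimage continuous_subtype_val) hxY
  obtain ⟨V, hV, hVX⟩ := isOpen_induced_iff.1
    (isOpen_interior (s := (Subtype.val ⁻¹' X : Set (cube n))))
  have hzV : z.1 ∈ V := by
    rw [← hVX] at hz
    exact hz
  have hzcl : z.1 ∈ closure (interior (cube n)) := closure_interior_cube.symm ▸ z.2
  have hopen : IsOpen (Yᶜ ∩ V) := hY.isOpen_compl.inter hV
  have hpos := (hopen.inter (isOpen_interior (s := cube n))).measure_pos volume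
    (mem_closure_iff.1 hzcl _ hopen ⟨hzY, hzV⟩)
  refine hpos.ne' (measure_mono_null ?_ hnull)
  rintro w ⟨⟨hwY, hwV⟩, hwc⟩
  have hw : (⟨w, interior_subset hwc⟩ : cube n) ∈ interior (Subtype.val ⁻¹' X : Set (cube n)) := by
    rw [← hVX]
    exact hwV
  have hwX : w ∈ X := interior_subset (s := (Subtype.val ⁻¹' X : Set (cube n))) hw
  exact ⟨hwX, hwY⟩

end Volume

/-- if the nonempty closed set `X ⊆ [0,1]^n` coincides with the closure of
its interior, relative to the space `[0,1]^n`, then `McN(X)` is hopfian: every surjective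
MV-endomorphism of `McN(X)` is injective. -/
theorem stmt11 {n : ℕ} (hn : 1 ≤ n) (X : Set (Fin n → ℝ)) (hXc : X ⊆ cube n)
    (hcl : IsClosed X) (hne : X.Nonempty)
    (hreg : (Subtype.val ⁻¹' X : Set ↥(cube n)) =
      closure (interior (Subtype.val ⁻¹' X : Set ↥(cube n)))) :
    ∀ σ : (↥X → ℝ) → (↥X → ℝ), IsMVEndo X σ →
      Set.SurjOn σ (McN X) (McN X) → Set.InjOn σ (McN X) := by
  intro σ hσ hsurj
  have hcomp : IsCompact X := isCompact_Icc.of_isClosed_subset hcl hXc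
  obtain ⟨η, hη⟩ := hσ.exists_comp hXc hcomp hne
  choose H hH hHη using fun i : Fin n => hσ.1 (apply_mem_McN (X := X) i)
  choose g hg hgσ using fun i : Fin n => hsurj (apply_mem_McN (X := X) i)
  choose G hG hGg using hg
  have hHη' (x : X) : (fun i => H i x.1) = (η x).1 := by
    funext i
    rw [← hHη, hη _ (apply_mem_McN i)]
    rfl
  have hmaps : MapsTo (fun x i => H i x) X X := fun x hx => by
    have := hHη' ⟨x, hx⟩
    simp only at this ⊢
    exact this ▸ (η ⟨x, hx⟩).2
  have hinv : LeftInvOn (fun x i => G i x) (fun x i => H i x) X := fun x hx => by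
    funext i
    have h1 := hHη' ⟨x, hx⟩
    have h2 := congrFun (hgσ i) ⟨x, hx⟩
    rw [hη _ ⟨G i, hG i, hGg i⟩, Function.comp_apply, hGg, ← h1] at h2
    exact h2
  have hclosed : IsClosed ((fun x i => H i x) '' X) :=
    (hcomp.image_of_continuousOn (continuousOn_pi.2 fun i => (hH i).1.mono hXc)).isClosed
  have hXY := subset_of_volume_le hXc hreg hmaps.image_subset hclosed
    (volume_le_volume_image hXc hcl hH hG hmaps hinv)
  intro f hf f' hf' hff
  funext y
  obtain ⟨x, hx, hxy⟩ := hXY y.2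
  have hy : y = η ⟨x, hx⟩ := Subtype.ext (hxy.symm.trans (hHη' ⟨x, hx⟩))
  rw [hη f hf, hη f' hf'] at hff
  rw [hy]
  exact congrFun hff ⟨x, hx⟩
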